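/- Let A be an invertible n×n real matrix and b ∈ ℝⁿ, with exact solution x = A⁻¹b. Suppose sequences (xₘ), (dₘ) in ℝⁿ satisfy xₘ₊₁ = xₘ + αₘ dₘ for every m, where αₘ = ⟨rₘ, A dₘ⟩ / ‖A dₘ‖² when A dₘ ≠ 0 and αₘ = 0 otherwise, and rₘ = b − A xₘ. Then for every m, ‖xₘ − x‖ ≤ ‖A⁻¹‖ · ‖r₀‖, where ‖A⁻¹‖ is the operator norm of A⁻¹ induced by the Euclidean vector norm. In particular, the iterates of stable iterative refinement never diverge. -/

import Mathlib

open scoped RealInnerProductSpace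
open Matrix

/-- Subtracting from `r` its component along `w` does not increase the norm. -/
lemma norm_sub_inner_div_smul_le {E : Type*} [NormedAddCommGroup E] [InnerProductSpace ℝ E]
    (r w : E) : ‖r - (⟪r, w⟫ / ‖w‖ ^ 2) • w‖ ≤ ‖r‖ := by
  rcases eq_or_ne w 0 with rfl | hw
  · simp
  · have hw' : ‖w‖ ≠ 0 := norm_ne_zero_iff.mpr hw
    refine (sq_le_sq₀ (norm_nonneg _) (norm_nonneg r)).mp ?_
    have key : ‖r - (⟪r, w⟫ / ‖w‖ ^ 2) • w‖ ^ 2 = ‖r‖ ^ 2 - (⟪r, w⟫ / ‖w‖) ^ 2 := by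
      rw [norm_sub_sq_real, real_inner_smul_right, norm_smul, mul_pow, Real.norm_eq_abs, sq_abs]
      field_simp
      ring
    rw [key]
    exact sub_le_self _ (sq_nonneg _)

/-- For the stable iterative refinement iteration applied to an invertible
system `A x = b` with exact solution `x = A⁻¹ b`, every iterate satisfies
`‖xₘ - x‖ ≤ ‖A⁻¹‖ ⬝ ‖r₀‖`, where `‖A⁻¹‖` is the operator norm of `A⁻¹` induced by the
Euclidean vector norm: the iterates never diverge. -/
theorem stmt_6 {n : ℕ} (A : Matrix (Fin n) (Fin n) ℝ) (hA : IsUnit A)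
    (b : EuclideanSpace ℝ (Fin n)) (xsol : EuclideanSpace ℝ (Fin n))
    (hxsol : xsol = toEuclideanLin A⁻¹ b)
    (x d : ℕ → EuclideanSpace ℝ (Fin n)) (r : ℕ → EuclideanSpace ℝ (Fin n)) (α : ℕ → ℝ)
    (hr : ∀ m, r m = b - toEuclideanLin A (x m))
    (hα : ∀ m, (toEuclideanLin A (d m) ≠ 0 →
        α m = ⟪r m, toEuclideanLin A (d m)⟫ / ‖toEuclideanLin A (d m)‖ ^ 2) ∧
      (toEuclideanLin A (d m) = 0 → α m = 0))
    (hx : ∀ m, x (m + 1) = x m + α m • d m) :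
    ∀ m, ‖x m - xsol‖ ≤ ‖toEuclideanCLM (𝕜 := ℝ) A⁻¹‖ * ‖r 0‖ := by
  have hanti : Antitone fun m => ‖r m‖ := antitone_nat_of_succ_le fun m => by
    have hstep : r (m + 1) = r m - α m • toEuclideanLin A (d m) := by
      rw [hr, hr, hx, map_add, map_smul, sub_sub]
    by_cases hw : toEuclideanLin A (d m) = 0
    · simp [hstep, hw]
    · rw [hstep, (hα m).1 hw]
      exact norm_sub_inner_div_smul_le _ _
  intro m
  have hinv : toEuclideanLin A⁻¹ (toEuclideanLin A (x m)) = x m := by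
    have hdet : IsUnit A.det := (A.isUnit_iff_isUnit_det).mp hA
    simp [toLpLin_apply, mulVec_mulVec, nonsing_inv_mul A hdet]
  have herr : xsol - x m = toEuclideanCLM (𝕜 := ℝ) A⁻¹ (r m) := by
    change _ = toEuclideanLin A⁻¹ (r m)
    rw [hr, map_sub, hinv, hxsol]
  rw [norm_sub_rev, herr]
  exact (ContinuousLinearMap.le_opNorm _ _).trans
    (mul_le_mul_of_nonneg_left (hanti m.zero_le) (norm_nonneg _))
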